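/- arXiv:0811.2103 — 3 statements merged into one kernel-verified Lean document; each statement's English description precedes it below -/
import Mathlib

section
/- Let Ω ⊆ ℝ^D be open, H = a·∇ a C^∞ vector field on Ω with a(x) ≠ 0 for all x ∈ Ω, and Σ a C^∞ hypersurface of Ω closed in Ω. Suppose x : (0,s₀) → Ω is a C¹ curve with x'(s) = a(x(s)) and x(s) ∈ Σ for every s ∈ (0,s₀) (a piece of a characteristic curve of H contained in Σ). Then for every ordinal α and every s ∈ (0,s₀), x(s) ∈ F(α;H;Σ); in particular F(α;H;Σ) ≠ ∅ for every ordinal α. -/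
noncomputable section
open Topology MeasureTheory


/-- The directional derivative `(Hf)(x) = a(x)·∇f(x)` of `f` along the vector field `a`. -/
def vfDeriv {D : ℕ} (a : (Fin D → ℝ) → (Fin D → ℝ)) (f : (Fin D → ℝ) → ℝ) :
    (Fin D → ℝ) → ℝ :=
  fun x => fderiv ℝ f x (a x)

/-- The iterate `H^k f` of the vector field `H = a·∇` applied to `f`. -/
def vfIter {D : ℕ} (a : (Fin D → ℝ) → (Fin D → ℝ)) :
    ℕ → ((Fin D → ℝ) → ℝ) → ((Fin D → ℝ) → ℝ)
  | 0, f => f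
  | k + 1, f => vfDeriv a (vfIter a k f)

/-- `γ` is a local defining function, on the open set `U ⊆ Ω`, for the hypersurface `S` of `Ω`. -/
def IsLocalDefining {D : ℕ} (Ω S U : Set (Fin D → ℝ)) (γ : (Fin D → ℝ) → ℝ) : Prop :=
  IsOpen U ∧ U ⊆ Ω ∧ ContDiffOn ℝ (⊤ : ℕ∞) γ U ∧ (∀ y ∈ U, fderiv ℝ γ y ≠ 0) ∧
    S ∩ U = {y ∈ U | γ y = 0}

/-- `S` is a `C^∞` hypersurface of the open set `Ω`. -/
def IsHypersurface {D : ℕ} (Ω S : Set (Fin D → ℝ)) : Prop :=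
  S ⊆ Ω ∧ ∀ x ∈ S, ∃ U γ, IsLocalDefining Ω S U γ ∧ x ∈ U

/-- The set `Σ(k;H)` of points of `S` where the vector field `H = a·∇` has contact of
exact order `k` with `S` (for `k = 0`, `H` is transverse to `S`). -/
def contactSet {D : ℕ} (a : (Fin D → ℝ) → (Fin D → ℝ)) (Ω S : Set (Fin D → ℝ)) (k : ℕ) :
    Set (Fin D → ℝ) :=
  {x | x ∈ S ∧ ∃ U γ, IsLocalDefining Ω S U γ ∧ x ∈ U ∧
    (∀ i, 1 ≤ i → i ≤ k → vfIter a i γ x = 0) ∧ vfIter a (k + 1) γ x ≠ 0}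

/-- The set `Σ(∞;H)` of points of `S` where `H = a·∇` is tangent to `S` at infinite order. -/
def contactInf {D : ℕ} (a : (Fin D → ℝ) → (Fin D → ℝ)) (Ω S : Set (Fin D → ℝ)) :
    Set (Fin D → ℝ) :=
  {x | x ∈ S ∧ ∃ U γ, IsLocalDefining Ω S U γ ∧ x ∈ U ∧
    ∀ i, 1 ≤ i → vfIter a i γ x = 0}

/-- The transfinite family `F(α;H;Σ)` of Definition 3.3. -/
def Fset {D : ℕ} (a : (Fin D → ℝ) → (Fin D → ℝ)) (Ω S : Set (Fin D → ℝ)) (α : Ordinal) :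
    Set (Fin D → ℝ) :=
  Ordinal.limitRecOn α (contactInf a Ω S)
    (fun _β Fβ => Fβ \ {x | ∃ U Θ, IsOpen U ∧ x ∈ U ∧ U ⊆ Ω ∧ IsHypersurface U Θ ∧
        Fβ ∩ U ⊆ Θ ∧ ∃ k : ℕ, x ∈ contactSet a U Θ k})
    (fun _α _ IH => ⋂ (β) (h : _), IH β h)

lemma vfIter_contDiffOn {D : ℕ} {Ω U : Set (Fin D → ℝ)} {a : (Fin D → ℝ) → (Fin D → ℝ)}
    {γ : (Fin D → ℝ) → ℝ} (ha : ContDiffOn ℝ (⊤ : ℕ∞) a Ω) (hU : IsOpen U) (hUΩ : U ⊆ Ω)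
    (hγ : ContDiffOn ℝ (⊤ : ℕ∞) γ U) (i : ℕ) :
    ContDiffOn ℝ (⊤ : ℕ∞) (vfIter a i γ) U := by
  induction i with
  | zero => exact hγ
  | succ k ih =>
    have h1 : ContDiffOn ℝ (⊤ : ℕ∞) (fderiv ℝ (vfIter a k γ)) U :=
      ih.fderiv_of_isOpen hU (by simp)
    exact h1.clm_apply (ha.mono hUΩ)

lemma vfIter_zero_on_curve {D : ℕ} {Ω U : Set (Fin D → ℝ)} {a : (Fin D → ℝ) → (Fin D → ℝ)}
    {γ : (Fin D → ℝ) → ℝ} (ha : ContDiffOn ℝ (⊤ : ℕ∞) a Ω) (hU : IsOpen U) (hUΩ : U ⊆ Ω)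
    (hγ : ContDiffOn ℝ (⊤ : ℕ∞) γ U) {x : ℝ → (Fin D → ℝ)} {s₀ : ℝ}
    (hx' : ∀ s ∈ Set.Ioo 0 s₀, HasDerivAt x (a (x s)) s)
    (h0 : ∀ s ∈ Set.Ioo 0 s₀, x s ∈ U → γ (x s) = 0) (i : ℕ) :
    ∀ s ∈ Set.Ioo 0 s₀, x s ∈ U → vfIter a i γ (x s) = 0 := by
  induction i with
  | zero => exact h0
  | succ k ih =>
    intro s hs hsU
    have hd : DifferentiableAt ℝ (vfIter a k γ) (x s) :=
      ((vfIter_contDiffOn ha hU hUΩ hγ k).contDiffAt (hU.mem_nhds hsU)).differentiableAt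
        (by simp)
    have h1 := hd.hasFDerivAt.comp_hasDerivAt s (hx' s hs)
    have h2 : (vfIter a k γ ∘ x) =ᶠ[𝓝 s] fun _ => (0 : ℝ) := by
      filter_upwards [isOpen_Ioo.mem_nhds hs,
        (hx' s hs).continuousAt.preimage_mem_nhds (hU.mem_nhds hsU)] with t ht htU
      exact ih t ht htU
    exact h1.unique ((hasDerivAt_const s (0 : ℝ)).congr_of_eventuallyEq h2)

lemma curve_mem_Fset
    {D : ℕ} {Ω S : Set (Fin D → ℝ)}
    {a : (Fin D → ℝ) → (Fin D → ℝ)} (ha : ContDiffOn ℝ (⊤ : ℕ∞) a Ω)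
    (hS : IsHypersurface Ω S)
    {x : ℝ → (Fin D → ℝ)} {s₀ : ℝ}
    (hx' : ∀ s ∈ Set.Ioo 0 s₀, HasDerivAt x (a (x s)) s)
    (hxS : ∀ s ∈ Set.Ioo 0 s₀, x s ∈ S) :
    ∀ α : Ordinal, ∀ s ∈ Set.Ioo 0 s₀, x s ∈ Fset a Ω S α := by
  intro α
  induction α using Ordinal.limitRecOn with
  | zero =>
    intro s hs
    unfold Fset
    rw [Ordinal.limitRecOn_zero]
    obtain ⟨U, γ, hd, hsU⟩ := hS.2 _ (hxS s hs)
    refine ⟨hxS s hs, U, γ, hd, hsU, fun i _ => ?_⟩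
    obtain ⟨hU, hUΩ, hγ, -, heq⟩ := hd
    refine vfIter_zero_on_curve ha hU hUΩ hγ hx' (fun t ht htU => ?_) i s hs hsU
    have : x t ∈ S ∩ U := ⟨hxS t ht, htU⟩
    rw [heq] at this
    exact this.2
  | add_one β ih =>
    intro s hs
    unfold Fset at ih ⊢
    rw [Ordinal.limitRecOn_add_one]
    refine ⟨ih s hs, ?_⟩
    rintro ⟨U, Θ, hU, hsU, hUΩ, hΘ, hsub, k, -, V, γ, ⟨hV, hVU, hγ, -, heq⟩, hsV, -, hne⟩
    refine hne (vfIter_zero_on_curve ha hV (hVU.trans hUΩ) hγ hx' (fun t ht htV => ?_) _ s hs hsV)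
    have : x t ∈ Θ ∩ V := ⟨hsub ⟨ih t ht, hVU htV⟩, htV⟩
    rw [heq] at this
    exact this.2
  | limit β hβ ih =>
    intro s hs
    unfold Fset at ih ⊢
    rw [Ordinal.limitRecOn_limit _ _ _ _ hβ]
    simp only [Set.mem_iInter]
    intro δ hδ
    exact ih δ hδ s hs

/-- if a piece of characteristic curve of `H = a·∇` is contained in `Σ`,
then it is contained in `F(α;H;Σ)` for every ordinal `α`; in particular all the sets
`F(α;H;Σ)` are nonempty. -/
theorem Fset_nonempty_of_characteristic_curve
    {D : ℕ} (hD : 1 ≤ D) (Ω S : Set (Fin D → ℝ)) (hΩ : IsOpen Ω)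
    (a : (Fin D → ℝ) → (Fin D → ℝ)) (ha : ContDiffOn ℝ (⊤ : ℕ∞) a Ω)
    (ha0 : ∀ x ∈ Ω, a x ≠ 0)
    (hS : IsHypersurface Ω S) (hScl : closure S ∩ Ω ⊆ S)
    (x : ℝ → (Fin D → ℝ)) (s₀ : ℝ) (hs₀ : 0 < s₀)
    (hxΩ : ∀ s ∈ Set.Ioo 0 s₀, x s ∈ Ω)
    (hx' : ∀ s ∈ Set.Ioo 0 s₀, HasDerivAt x (a (x s)) s)
    (hxS : ∀ s ∈ Set.Ioo 0 s₀, x s ∈ S) :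
    (∀ α : Ordinal, ∀ s ∈ Set.Ioo 0 s₀, x s ∈ Fset a Ω S α) ∧
      ∀ α : Ordinal, (Fset a Ω S α).Nonempty := by
  exact ⟨curve_mem_Fset ha hS hx' hxS, fun α =>
    ⟨x (s₀ / 2), curve_mem_Fset ha hS hx' hxS α _ ⟨by linarith, by linarith⟩⟩⟩
end
end

section
/- Let Π₁, …, Π_m : ℝ^d × ℝ^d → ℂ^{N×N} be C^1 matrix-valued functions such that for all (x,ξ): Π_l(x,ξ)² = Π_l(x,ξ) for all l, Π_l(x,ξ) Π_{l'}(x,ξ) = 0 for l ≠ l', and Σ_{l=1}^m Π_l(x,ξ) = Id. Then for every j, identically: Π_j {Π_j, Π_j} Π_j = Σ_{k ≠ j} Π_j {Π_k, Π_k} Π_j, where {·,·} is the matrix Poisson bracket. -/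
noncomputable section

/-- The phase space `ℝ^d_x × ℝ^d_ξ`. -/
abbrev Phase (d : ℕ) := (Fin d → ℝ) × (Fin d → ℝ)

/-- The direction of the coordinate `x_l` in the phase space. -/
def xDir (d : ℕ) (l : Fin d) : Phase d := (Pi.single l 1, 0)

/-- The direction of the coordinate `ξ_l` in the phase space. -/
def xiDir (d : ℕ) (l : Fin d) : Phase d := (0, Pi.single l 1)

/-- Entrywise directional derivative of a matrix-valued function on phase space. -/
def matDirDeriv {d N : ℕ} (A : Phase d → Matrix (Fin N) (Fin N) ℂ) (v : Phase d)
    (z : Phase d) : Matrix (Fin N) (Fin N) ℂ :=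
  Matrix.of fun p q => fderiv ℝ (fun w => A w p q) z v

/-- The matrix Poisson bracket
`{A,B} = Σ_l (∂_{ξ_l}A)(∂_{x_l}B) − (∂_{x_l}A)(∂_{ξ_l}B)` (matrix products). -/
def matPoisson {d N : ℕ} (A B : Phase d → Matrix (Fin N) (Fin N) ℂ) (z : Phase d) :
    Matrix (Fin N) (Fin N) ℂ :=
  ∑ l, (matDirDeriv A (xiDir d l) z * matDirDeriv B (xDir d l) z
      - matDirDeriv A (xDir d l) z * matDirDeriv B (xiDir d l) z)

/-- The Poisson bracket `{λ,B}` of a scalar function with a matrix-valued function. -/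
def scalMatPoisson {d N : ℕ} (lam : Phase d → ℂ) (B : Phase d → Matrix (Fin N) (Fin N) ℂ)
    (z : Phase d) : Matrix (Fin N) (Fin N) ℂ :=
  ∑ l, ((fderiv ℝ lam z (xiDir d l)) • matDirDeriv B (xDir d l) z
      - (fderiv ℝ lam z (xDir d l)) • matDirDeriv B (xiDir d l) z)

/-- A matrix-valued function is `C^1` iff all its entries are. -/
def MatC1 {d N : ℕ} (A : Phase d → Matrix (Fin N) (Fin N) ℂ) : Prop :=
  ∀ p q, ContDiff ℝ 1 fun z => A z p q

theorem matDirDeriv_mul_aux {d N : ℕ} (A B : Phase d → Matrix (Fin N) (Fin N) ℂ)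
    (hA : MatC1 A) (hB : MatC1 B) (v z : Phase d) :
    matDirDeriv (fun w => A w * B w) v z
      = matDirDeriv A v z * B z + A z * matDirDeriv B v z := by
  ext p q
  have hA' : ∀ p q, DifferentiableAt ℝ (fun w => A w p q) z := fun p q =>
    ((hA p q).differentiable one_ne_zero).differentiableAt
  have hB' : ∀ p q, DifferentiableAt ℝ (fun w => B w p q) z := fun p q =>
    ((hB p q).differentiable one_ne_zero).differentiableAt
  simp only [matDirDeriv, Matrix.of_apply, Matrix.add_apply, Matrix.mul_apply]
  rw [fderiv_fun_sum (fun i _ => (hA' p i).fun_mul (hB' i q)), ← Finset.sum_add_distrib,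
    ContinuousLinearMap.sum_apply]
  refine Finset.sum_congr rfl fun i _ => ?_
  rw [fderiv_fun_mul (hA' p i) (hB' i q)]
  simp only [ContinuousLinearMap.add_apply, ContinuousLinearMap.smul_apply, smul_eq_mul]
  ring

theorem proj_term_aux {d N m : ℕ} (P : Fin m → Phase d → Matrix (Fin N) (Fin N) ℂ)
    (hP : ∀ l, MatC1 (P l))
    (hproj : ∀ l z, P l z * P l z = P l z)
    (horth : ∀ l l', l ≠ l' → ∀ z, P l z * P l' z = 0)
    (hsum : ∀ z, ∑ l, P l z = 1) (j : Fin m) (z u v : Phase d) :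
    P j z * (matDirDeriv (P j) u z * matDirDeriv (P j) v z) * P j z =
      ∑ k ∈ Finset.univ.filter (fun k => k ≠ j),
        P j z * (matDirDeriv (P k) u z * matDirDeriv (P k) v z) * P j z := by
  have hjj : ∀ w, matDirDeriv (P j) w z * P j z + P j z * matDirDeriv (P j) w z
      = matDirDeriv (P j) w z := by
    intro w
    rw [← matDirDeriv_mul_aux _ _ (hP j) (hP j)]
    simp only [hproj]
  have h0 : ∀ a b, a ≠ b → ∀ w,
      matDirDeriv (P a) w z * P b z + P a z * matDirDeriv (P b) w z = 0 := by
    intro a b hab w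
    rw [← matDirDeriv_mul_aux _ _ (hP a) (hP b)]
    simp only [horth a b hab]
    ext p q
    simp [matDirDeriv]
  have hk : ∀ k ∈ Finset.univ.filter (fun k => k ≠ j),
      P j z * (matDirDeriv (P k) u z * matDirDeriv (P k) v z) * P j z
        = matDirDeriv (P j) u z * P k z * matDirDeriv (P j) v z := by
    intro k hk
    have hne : k ≠ j := (Finset.mem_filter.mp hk).2
    have h1 := eq_neg_of_add_eq_zero_right (h0 j k hne.symm u)
    have h2 := eq_neg_of_add_eq_zero_left (h0 k j hne v)
    calc _ = (P j z * matDirDeriv (P k) u z) * (matDirDeriv (P k) v z * P j z) := by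
          simp only [Matrix.mul_assoc]
      _ = matDirDeriv (P j) u z * (P k z * P k z) * matDirDeriv (P j) v z := by
          rw [h1, h2, neg_mul_neg]
          simp only [Matrix.mul_assoc]
      _ = _ := by rw [hproj]
  have hS : ∑ k ∈ Finset.univ.filter (fun k => k ≠ j), P k z = 1 - P j z := by
    rw [← hsum z, Finset.filter_ne', ← Finset.add_sum_erase _ _ (Finset.mem_univ j)]
    abel
  rw [Finset.sum_congr rfl hk, ← Finset.sum_mul, ← Finset.mul_sum, hS]
  have e1 : P j z * matDirDeriv (P j) u z = matDirDeriv (P j) u z * (1 - P j z) := by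
    rw [mul_sub, mul_one]; exact eq_sub_of_add_eq' (hjj u)
  have e2 : matDirDeriv (P j) v z * P j z = (1 - P j z) * matDirDeriv (P j) v z := by
    rw [sub_mul, one_mul]; exact eq_sub_of_add_eq (hjj v)
  have e3 : (1 - P j z) * (1 - P j z) = 1 - P j z := by
    rw [sub_mul, one_mul, mul_sub, mul_one, hproj, sub_self, sub_zero]
  calc _ = (P j z * matDirDeriv (P j) u z) * (matDirDeriv (P j) v z * P j z) := by
        simp only [Matrix.mul_assoc]
    _ = matDirDeriv (P j) u z * ((1 - P j z) * (1 - P j z)) * matDirDeriv (P j) v z := by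
        rw [e1, e2]; simp only [Matrix.mul_assoc]
    _ = _ := by rw [e3]

/-- for a `C^1` family of mutually orthogonal projections summing to the
identity, `Π_j {Π_j,Π_j} Π_j = Σ_{k≠j} Π_j {Π_k,Π_k} Π_j`. -/
theorem proj_matPoisson_sum
    {d N m : ℕ} (P : Fin m → Phase d → Matrix (Fin N) (Fin N) ℂ)
    (hP : ∀ l, MatC1 (P l))
    (hproj : ∀ l z, P l z * P l z = P l z)
    (horth : ∀ l l', l ≠ l' → ∀ z, P l z * P l' z = 0)
    (hsum : ∀ z, ∑ l, P l z = 1) :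
    ∀ j, ∀ z : Phase d,
      P j z * matPoisson (P j) (P j) z * P j z =
        ∑ k ∈ Finset.univ.filter (fun k => k ≠ j),
          P j z * matPoisson (P k) (P k) z * P j z := by
  intro j z
  simp only [matPoisson, Finset.mul_sum, Finset.sum_mul, mul_sub, sub_mul]
  rw [Finset.sum_comm]
  refine Finset.sum_congr rfl fun l _ => ?_
  rw [Finset.sum_sub_distrib, ← proj_term_aux P hP hproj horth hsum,
    ← proj_term_aux P hP hproj horth hsum]
end
end

section
/- Let η > 0, let d₁ : ℝ → ℝ be C^∞, and let χ : ℝ → ℝ be C^∞ with χ(t) = 0 for t ∈ [0,1] and χ(t) > 0 for t ∉ [0,1]. Define g : ℝ → ℝ by g(t) = exp(−1/|t|)·t/|t|³ for t ≠ 0 and g(0) = 0. Then the curve ρ(s) = (x₁(s), x₂(s), ξ₁(s), ξ₂(s)) = (0, sη, 0, η) satisfies, for every s ∈ [0, 1/η] and for both choices of sign ±: x₁'(s) = ξ₁(s), x₂'(s) = ξ₂(s), ξ₁'(s) = −χ(x₂(s)) d₁'(x₁(s)) ∓ g(x₁(s)), ξ₂'(s) = −χ'(x₂(s)) d₁(x₁(s)).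 In particular, the Hamiltonian trajectories of both modes λ^±(x) = χ(x₂)d₁(x₁) ± exp(−1/|x₁|) issued from (x₁,x₂,ξ₁,ξ₂)(0) = (0,0,0,η) coincide on [0,1/η] and remain in the crossing set {x₁ = 0}. -/
noncomputable section

/-- `g(t) = exp(−1/|t|)·t/|t|³` for `t ≠ 0`, `g(0) = 0` (the `x₁`-derivative of
`∓exp(−1/|x₁|)`, with the convention that it vanishes at `x₁ = 0`). -/
def gfun (t : ℝ) : ℝ := if t = 0 then 0 else Real.exp (-(1 / |t|)) * t / |t| ^ 3

/-- the curve `ρ(s) = (0, sη, 0, η)` solves the Hamiltonian equations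
of both modes `λ^± = |ξ|²/2 + χ(x₂)d₁(x₁) ± exp(−1/|x₁|)` on `[0, 1/η]`, and stays in
the crossing set `{x₁ = 0}`. -/
theorem degenerate_trajectory_in_crossing
    (η : ℝ) (hη : 0 < η)
    (d₁ : ℝ → ℝ) (hd₁ : ContDiff ℝ (⊤ : ℕ∞) d₁)
    (χ : ℝ → ℝ) (hχ : ContDiff ℝ (⊤ : ℕ∞) χ)
    (hχ0 : ∀ t ∈ Set.Icc (0 : ℝ) 1, χ t = 0)
    (hχpos : ∀ t : ℝ, t ∉ Set.Icc (0 : ℝ) 1 → 0 < χ t)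
    (x₁ ξ₁ x₂ ξ₂ : ℝ → ℝ)
    (hx₁ : x₁ = fun _ => 0) (hx₂ : x₂ = fun s => s * η)
    (hξ₁ : ξ₁ = fun _ => 0) (hξ₂ : ξ₂ = fun _ => η) :
    ∀ s ∈ Set.Icc (0 : ℝ) (1 / η), ∀ ε : ℝ, ε = 1 ∨ ε = -1 →
      HasDerivAt x₁ (ξ₁ s) s ∧
      HasDerivAt x₂ (ξ₂ s) s ∧
      HasDerivAt ξ₁ (-χ (x₂ s) * deriv d₁ (x₁ s) - ε * gfun (x₁ s)) s ∧
      HasDerivAt ξ₂ (-deriv χ (x₂ s) * d₁ (x₁ s)) s ∧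
      x₁ s = 0 := by
  intro s hs ε _
  subst hx₁ hx₂ hξ₁ hξ₂
  have hmem : s * η ∈ Set.Icc (0 : ℝ) 1 :=
    ⟨mul_nonneg hs.1 hη.le, (le_div_iff₀ hη).1 hs.2⟩
  have h0 := hχ0 _ hmem
  have hmin : IsLocalMin χ (s * η) := Filter.Eventually.of_forall fun t => by
    rw [h0]
    by_cases ht : t ∈ Set.Icc (0 : ℝ) 1
    · exact (hχ0 t ht).ge
    · exact (hχpos t ht).le
  have hd : deriv χ (s * η) = 0 := hmin.deriv_eq_zero
  refine ⟨hasDerivAt_const s 0, ?_, ?_, ?_, rfl⟩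
  · simpa using (hasDerivAt_id s).mul_const η
  · simpa [h0, gfun] using hasDerivAt_const s (0 : ℝ)
  · simpa [hd] using hasDerivAt_const s η
end
end
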